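/- arXiv:1412.5957 — 4 statements merged into one kernel-verified Lean document; each statement's English description precedes it below -/
import Mathlib

section
/- Let n ≥ 1 and let j be an integer with 1 ≤ j < q^n − 1. Then S_n(j) = 0, i.e. the sum of the j-th powers of all monic polynomials of degree n in A vanishes. -/
open Polynomial

/-- `S n j = Σ_{a monic, deg a = n} a^j`, where monic polynomials of degree `n`
over `F` are parametrized bijectively by their lower-order coefficients `c : Fin n → F`. -/
noncomputable def Smon (F : Type) [Field F] [Fintype F] (n j : ℕ) : Polynomial F :=
  ∑ c : Fin n → F, (X ^ n + ∑ i : Fin n, C (c i) * X ^ (i : ℕ)) ^ j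

/-- Sums of small powers over a translate of a finite additive subgroup of a field vanish. -/
theorem AddMonoidHom.sum_add_pow_eq_zero {G K : Type*} [AddGroup G] [Fintype G] [Field K]
    (g : G →+ K) (hg : Function.Injective g) (a : K) {j : ℕ} (hj : j < Fintype.card G - 1) :
    ∑ c, (a + g c) ^ j = 0 := by
  classical
  let D : K := ∏ d ∈ Finset.univ.erase (0 : G), g d
  have hD0 : D ≠ 0 := Finset.prod_ne_zero_iff.2 fun d hd ↦
    (map_ne_zero_iff g hg).2 (Finset.ne_of_mem_erase hd)
  have hprod (c : G) : ∏ d ∈ Finset.univ.erase c, ((a + g c) - (a + g d)) = D := by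
    refine Finset.prod_bij' (fun d _ ↦ c - d) (fun d _ ↦ -d + c) ?_ ?_ ?_ ?_ ?_
    · intro d hd
      simpa [sub_eq_zero, eq_comm] using hd
    · intro d hd
      simpa [neg_add_eq_iff_eq_add] using hd
    · simp
    · simp
    · simp
  have hinj : Set.InjOn (fun c ↦ a + g c) (Finset.univ : Finset G) :=
    ((add_right_injective a).comp hg).injOn
  have hdeg : (X ^ j : K[X]).degree < (Finset.univ : Finset G).card := by
    rw [degree_X_pow, Finset.card_univ]
    exact_mod_cast (show j < Fintype.card G by omega)
  have key := Lagrange.coeff_eq_sum hinj hdeg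
  simp only [hprod, eval_pow, eval_X, coeff_X_pow, Finset.card_univ, if_neg hj.ne',
    ← Finset.sum_div] at key
  simpa [hD0] using key.symm

/-- If `1 ≤ j < q^n - 1` then the sum of the `j`-th powers of all monic polynomials
of degree `n ≥ 1` over `𝔽_q` vanishes. -/
theorem stmt0 (F : Type) [Field F] [Fintype F] (hq : 3 ≤ Fintype.card F)
    (n j : ℕ) (hn : 1 ≤ n) (hj1 : 1 ≤ j) (hj2 : j < Fintype.card F ^ n - 1) :
    Smon F n j = 0 := by
  let g : (Fin n → F) →+ F[X] :=
    ((degreeLT F n).subtype ∘ₗ (degreeLTEquiv F n).symm.toLinearMap).toAddMonoidHom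
  have hg : Function.Injective g :=
    Subtype.val_injective.comp (degreeLTEquiv F n).symm.injective
  have hgc (c : Fin n → F) : g c = ∑ i : Fin n, C (c i) * X ^ (i : ℕ) := by
    simp only [C_mul_X_pow_eq_monomial]
    rfl
  have hι := IsFractionRing.injective F[X] (FractionRing F[X])
  apply hι
  have := AddMonoidHom.sum_add_pow_eq_zero
    ((algebraMap F[X] (FractionRing F[X])).toAddMonoidHom.comp g) (hι.comp hg)
    (algebraMap F[X] (FractionRing F[X]) (X ^ n)) (j := j) (by simpa using hj2)
  simpa [Smon, hgc] using this
end

section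
/- For every integer j ≥ 0, the Bernoulli–Goss number satisfies β(j) ≡ 1 (mod θ^q − θ) in A; in particular β(j) ≠ 0. -/
open Polynomial

/-- `Z(X,j) = Σ_{n=0}^{j+1} S_n(j) X^n ∈ A[X]` (which equals the full sum `Σ_{n≥0}`
since `S_n(j) = 0` for `q^n - 1 > j`). -/
noncomputable def Zpoly (F : Type) [Field F] [Fintype F] (j : ℕ) :
    Polynomial (Polynomial F) :=
  ∑ n ∈ Finset.range (j + 2), C (Smon F n j) * X ^ n

/-- The Bernoulli–Goss number `β(j) ∈ A`:  `β(j) = Z(1,j)` if `j = 0` or `(q-1) ∤ j`,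
and `β(j) = -(d/dX)Z(X,j)|_{X=1}` if `j ≥ 1` and `(q-1) ∣ j`. -/
noncomputable def bg (F : Type) [Field F] [Fintype F] (j : ℕ) : Polynomial F :=
  if j = 0 ∨ ¬ ((Fintype.card F - 1) ∣ j) then (Zpoly F j).eval 1
  else -((Polynomial.derivative (Zpoly F j)).eval 1)

theorem sum_pow_of_ne_zero (F : Type) [Field F] [Fintype F] {j : ℕ} (hj : j ≠ 0) :
    ∑ x : F, x ^ j = if Fintype.card F - 1 ∣ j then -1 else 0 := by
  classical
  rw [← FiniteField.sum_pow_units, Fintype.sum_eq_add_sum_subtype_ne _ 0, zero_pow hj, zero_add]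
  exact (Fintype.sum_equiv unitsEquivNeZero _ _ fun _ => by simp).symm

theorem sum_pow_eq_zero (F : Type) [Field F] [Fintype F] {j : ℕ}
    (h : j = 0 ∨ ¬ (Fintype.card F - 1) ∣ j) : ∑ x : F, x ^ j = 0 := by
  rcases eq_or_ne j 0 with rfl | hj
  · simp
  · rw [sum_pow_of_ne_zero F hj, if_neg (h.resolve_left hj)]

theorem eval_Smon_zero (F : Type) [Field F] [Fintype F] (j : ℕ) (a : F) :
    (Smon F 0 j).eval a = 1 := by
  simp [Smon]

theorem eval_Smon_succ (F : Type) [Field F] [Fintype F] (n j : ℕ) (a : F) :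
    (Smon F (n + 1) j).eval a = (Fintype.card F : F) ^ n * ∑ x : F, x ^ j := by
  have key (d : Fin n → F) :
      ∑ x : F, (a ^ (n + 1) + (x + ∑ i : Fin n, d i * a ^ ((i : ℕ) + 1))) ^ j =
        ∑ x : F, x ^ j := by
    refine Fintype.sum_equiv
      (Equiv.addLeft (a ^ (n + 1) + ∑ i : Fin n, d i * a ^ ((i : ℕ) + 1))) _ _ fun x => ?_
    simp only [Equiv.coe_addLeft]
    congr 1
    ring
  rw [Smon, eval_finsetSum, ← (Fin.consEquiv fun _ : Fin (n + 1) => F).sum_comp,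
    Fintype.sum_prod_type_right]
  simp [eval_finsetSum, Fin.sum_univ_succ, Fin.consEquiv, key]

theorem eval_Smon_add_two (F : Type) [Field F] [Fintype F] (n j : ℕ) (a : F) :
    (Smon F (n + 2) j).eval a = 0 := by
  simp [eval_Smon_succ]

theorem eval_bg (F : Type) [Field F] [Fintype F] (j : ℕ) (a : F) : (bg F j).eval a = 1 := by
  have sum_eq (f : ℕ → F) : ∑ n ∈ Finset.range (j + 2), f n * (Smon F n j).eval a =
      f 0 + f 1 * ∑ x : F, x ^ j := by
    rw [Finset.sum_range_succ', Finset.sum_range_succ']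
    simp only [add_assoc, Nat.reduceAdd, eval_Smon_add_two, mul_zero, Finset.sum_const_zero]
    simp [eval_Smon_succ F 0, eval_Smon_zero, add_comm]
  rw [bg]
  split_ifs with h
  · have hZ := sum_eq fun _ => 1
    simpa [Zpoly, eval_finsetSum, sum_pow_eq_zero F h] using hZ
  · have hZ := sum_eq fun n => n
    push Not at h
    rw [sum_pow_of_ne_zero F h.1, if_pos h.2] at hZ
    simp only [mul_comm (Nat.cast _ : F)] at hZ
    simp [Zpoly, eval_finsetSum, derivative_X_pow, hZ]

theorem X_pow_card_sub_X_dvd_of_eval_eq_zero (F : Type) [Field F] [Fintype F] (p : F[X])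
    (h : ∀ a, p.eval a = 0) : X ^ Fintype.card F - X ∣ p := by
  have hprod : ∏ a : F, (X - C a) = X ^ Fintype.card F - X := by
    have hq := Fintype.one_lt_card (α := F)
    have := prod_multiset_X_sub_C_of_monic_of_roots_card_eq
      (monic_X_pow_sub (p := (X : F[X])) (n := Fintype.card F) (by simpa using hq))
      (by rw [FiniteField.roots_X_pow_card_sub_X, FiniteField.X_pow_card_sub_X_natDegree_eq F hq]
          rfl)
    rwa [FiniteField.roots_X_pow_card_sub_X] at this
  rw [← hprod]
  exact Finset.prod_dvd_of_coprime
    (fun a _ b _ hab => pairwise_coprime_X_sub_C Function.injective_id hab)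
    fun a _ => dvd_iff_isRoot.mpr (h a)

/-- For every `j ≥ 0`, `β(j) ≡ 1 (mod θ^q - θ)` in `A = 𝔽_q[θ]`; in particular `β(j) ≠ 0`. -/
theorem stmt2 (F : Type) [Field F] [Fintype F] (hq : 3 ≤ Fintype.card F) (j : ℕ) :
    (X ^ (Fintype.card F) - X) ∣ (bg F j - 1) ∧ bg F j ≠ 0 := by
  refine ⟨X_pow_card_sub_X_dvd_of_eval_eq_zero F _ fun a => by simp [eval_bg], fun h => ?_⟩
  simpa [h] using eval_bg F j 0
end

section
/- Let π ∈ A be monic irreducible of degree d ≥ 1, and let j ≥ 1 be an integer with (q−1) | j. Then for every integer N ≥ j + d, Σ_{a ∈ A_+, deg a ≤ N, π ∤ a} a^j = 0 in A, where A_+ is the set of monic polynomials of A. (This is the integer specialization of the paper's Lemma: L_𝔭(1, y, ω_𝔭^i) = 0 for all y ∈ ℤ_p when i ≡ 0 (mod q−1).) -/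
open Polynomial

open scoped Classical in
/-- The restricted sum `Σ_{a monic, deg a = n, π ∤ a} a^j`, where monic polynomials of
degree `n` over `F` are parametrized bijectively by their lower-order coefficients
`c : Fin n → F`. -/
noncomputable def SmonCoprime (F : Type) [Field F] [Fintype F] (π : Polynomial F)
    (n j : ℕ) : Polynomial F :=
  ∑ c ∈ Finset.univ.filter (fun c : Fin n → F =>
      ¬ π ∣ (X ^ n + ∑ i : Fin n, C (c i) * X ^ (i : ℕ))),
    (X ^ n + ∑ i : Fin n, C (c i) * X ^ (i : ℕ)) ^ j

/-- Over an affine family with more than `j` parameters in `F`, the `j`-th powers sum to zero. -/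
theorem sum_add_linear_pow_eq_zero {F R : Type*} [Field F] [Fintype F] [CommRing R] [Algebra F R]
    (m : ℕ) : ∀ (j : ℕ) (_ : j < m) (w : R) (v : Fin m → R),
      ∑ c : Fin m → F, (w + ∑ i, c i • v i) ^ j = 0 := by
  induction m with
  | zero => intro j hj; omega
  | succ m ih =>
    intro j hj w v
    rw [← (Fin.consEquiv fun _ : Fin (m + 1) => F).sum_comp, Fintype.sum_prod_type]
    have expand (u : F) (c : Fin m → F) :
        (w + ∑ i, (Fin.consEquiv fun _ : Fin (m + 1) => F) (u, c) i • v i) ^ j =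
          ∑ k ∈ Finset.range (j + 1),
            (w + ∑ i, c i • v i.succ) ^ k * ((u • v 0) ^ (j - k) * (j.choose k : R)) := by
      rw [Fin.sum_univ_succ]
      simp only [Fin.consEquiv_apply, Fin.cons_zero, Fin.cons_succ]
      rw [add_left_comm, add_comm, add_pow]
      simp only [mul_assoc]
    simp only [expand]
    simp_rw [Finset.sum_comm (s := (Finset.univ : Finset (Fin m → F))), ← Finset.sum_mul]
    rw [Finset.sum_comm]
    refine Finset.sum_eq_zero fun k hk => ?_
    rcases (Nat.lt_succ_iff.mp (Finset.mem_range.mp hk)).lt_or_eq with h | rfl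
    · refine Finset.sum_eq_zero fun u _ => ?_
      rw [ih k (by omega), zero_mul]
    · have hq : (Fintype.card F : R) = 0 := by
        rw [← map_natCast (algebraMap F R), Nat.cast_card_eq_zero, map_zero]
      simp [hq]

/-- The `j`-th powers of the values of a linear map on a finite space of dimension greater
than `j` sum to zero. -/
theorem sum_linearMap_pow_eq_zero {F R W : Type*} [Field F] [Fintype F] [CommRing R] [Algebra F R]
    [AddCommGroup W] [Module F W] [Fintype W] (L : W →ₗ[F] R) (j : ℕ)
    (hj : j < Module.finrank F W) : ∑ x : W, L x ^ j = 0 := by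
  let b := Module.finBasis F W
  rw [← b.equivFun.symm.toEquiv.sum_comp]
  simpa [b.equivFun_symm_apply] using
    sum_add_linear_pow_eq_zero (F := F) _ j hj 0 fun i => L (b i)

/-- The polynomial of degree less than `m` with prescribed coefficients. -/
noncomputable def polyOfCoeffs (F : Type*) [Field F] (m : ℕ) : (Fin m → F) →ₗ[F] F[X] :=
  Fintype.linearCombination F fun i : Fin m => (X ^ (i : ℕ) : F[X])

theorem polyOfCoeffs_apply {F : Type*} [Field F] {m : ℕ} (c : Fin m → F) :
    polyOfCoeffs F m c = ∑ i, C (c i) * X ^ (i : ℕ) := by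
  simp [polyOfCoeffs, Fintype.linearCombination_apply, smul_eq_C_mul]

theorem polyOfCoeffs_snoc {F : Type*} [Field F] {m : ℕ} (u : F) (c : Fin m → F) :
    polyOfCoeffs F (m + 1) ((Fin.snocEquiv fun _ : Fin (m + 1) => F) (u, c)) =
      C u * X ^ m + polyOfCoeffs F m c := by
  simp [polyOfCoeffs_apply, Fin.sum_univ_castSucc, add_comm]

open scoped Classical in
/-- The sum of the `j`-th powers of all polynomials of degree less than `m` prime to `π`. -/
noncomputable def sumCoprime (F : Type) [Field F] [Fintype F] (π : F[X]) (m j : ℕ) : F[X] :=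
  ∑ c : Fin m → F, if π ∣ polyOfCoeffs F m c then 0 else polyOfCoeffs F m c ^ j

theorem sumCoprime_succ (F : Type) [Field F] [Fintype F] (π : F[X]) (m j : ℕ)
    (hdvd : (Fintype.card F - 1) ∣ j) :
    sumCoprime F π (m + 1) j = sumCoprime F π m j - SmonCoprime F π m j := by
  classical
  have hS : SmonCoprime F π m j = ∑ c : Fin m → F,
      if π ∣ X ^ m + polyOfCoeffs F m c then 0 else (X ^ m + polyOfCoeffs F m c) ^ j := by
    simp only [SmonCoprime, polyOfCoeffs_apply, Finset.sum_filter, ite_not]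
  have hunit (u : F) (hu : u ≠ 0) :
      (∑ c : Fin m → F, if π ∣ C u * X ^ m + polyOfCoeffs F m c then 0
        else (C u * X ^ m + polyOfCoeffs F m c) ^ j) = SmonCoprime F π m j := by
    rw [hS, ← (LinearEquiv.smulOfNeZero F (Fin m → F) u hu).toEquiv.sum_comp]
    refine Finset.sum_congr rfl fun c _ => ?_
    have hc : C u * X ^ m + polyOfCoeffs F m (u • c) = C u * (X ^ m + polyOfCoeffs F m c) := by
      rw [map_smul, smul_eq_C_mul, mul_add]
    have hj : u ^ j = 1 := by
      obtain ⟨k, rfl⟩ := hdvd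
      rw [pow_mul, FiniteField.pow_card_sub_one_eq_one u hu, one_pow]
    have hCu : IsUnit (C u) := isUnit_C.mpr hu.isUnit
    simp only [LinearEquiv.coe_toEquiv, LinearEquiv.smulOfNeZero_apply, hc, hCu.dvd_mul_left,
      mul_pow, ← C_pow, hj, C_1, one_mul]
  have hcard : ((Fintype.card F - 1 : ℕ) : F[X]) = -1 := by
    rw [Nat.cast_sub Fintype.card_pos, ← map_natCast C, Nat.cast_card_eq_zero]
    simp
  rw [sumCoprime, ← (Fin.snocEquiv fun _ : Fin (m + 1) => F).sum_comp, Fintype.sum_prod_type]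
  simp only [polyOfCoeffs_snoc]
  rw [← Finset.add_sum_erase _ _ (Finset.mem_univ (0 : F)),
    Finset.sum_congr rfl fun u hu => hunit u (Finset.ne_of_mem_erase hu)]
  simp [sumCoprime, Finset.card_erase_of_mem, hcard, sub_eq_add_neg]

theorem sumCoprime_eq_neg_sum (F : Type) [Field F] [Fintype F] (π : F[X]) (m j : ℕ)
    (hdvd : (Fintype.card F - 1) ∣ j) :
    sumCoprime F π m j = -∑ n ∈ Finset.range m, SmonCoprime F π n j := by
  induction m with
  | zero => simp [sumCoprime, polyOfCoeffs_apply]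
  | succ m ih => rw [sumCoprime_succ F π m j hdvd, ih, Finset.sum_range_succ]; ring

theorem sumCoprime_eq_zero (F : Type) [Field F] [Fintype F] (π : F[X]) (hπ : π ≠ 0) (m j : ℕ)
    (hm : j + π.natDegree < m) : sumCoprime F π m j = 0 := by
  classical
  let φ : (Fin m → F) →ₗ[F] AdjoinRoot π :=
    (AdjoinRoot.mkₐ π).toLinearMap ∘ₗ polyOfCoeffs F m
  have hφ (c : Fin m → F) : c ∈ LinearMap.ker φ ↔ π ∣ polyOfCoeffs F m c := by
    simp [φ, AdjoinRoot.mk_eq_zero]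
  have hrank : j < Module.finrank F (LinearMap.ker φ) := by
    have : Module.Finite F (AdjoinRoot π) := (AdjoinRoot.powerBasis hπ).finite
    have h₁ := φ.finrank_range_add_finrank_ker
    have h₂ := Submodule.finrank_le (LinearMap.range φ)
    rw [(AdjoinRoot.powerBasis hπ).finrank, AdjoinRoot.powerBasis_dim] at h₂
    rw [Module.finrank_fin_fun] at h₁
    omega
  have hall : ∑ c : Fin m → F, polyOfCoeffs F m c ^ j = 0 :=
    sum_linearMap_pow_eq_zero _ j (by rw [Module.finrank_fin_fun]; omega)
  have hker : ∑ c : Fin m → F with π ∣ polyOfCoeffs F m c, polyOfCoeffs F m c ^ j = 0 := by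
    rw [Finset.sum_subtype (p := (· ∈ LinearMap.ker φ)) _ (by simp [hφ])]
    exact sum_linearMap_pow_eq_zero (polyOfCoeffs F m ∘ₗ (LinearMap.ker φ).subtype) j hrank
  rw [← Finset.sum_filter_add_sum_filter_not _ fun c => π ∣ polyOfCoeffs F m c, hker,
    zero_add, Finset.sum_filter] at hall
  simpa only [sumCoprime, ite_not] using hall

/-- For `π` monic irreducible of degree `d ≥ 1` and `j ≥ 1` with `(q-1) ∣ j`, for every
`N ≥ j + d` one has `Σ_{a ∈ A_+, deg a ≤ N, π ∤ a} a^j = 0` in `A` (summing over monic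
polynomials of each degree `n ≤ N`). -/
theorem stmt7 (F : Type) [Field F] [Fintype F] (hq : 3 ≤ Fintype.card F)
    (π : Polynomial F) (d : ℕ) (hd : 1 ≤ d) (hπm : π.Monic) (hπi : Irreducible π)
    (hπd : π.natDegree = d) (j : ℕ) (hj : 1 ≤ j) (hdvd : (Fintype.card F - 1) ∣ j)
    (N : ℕ) (hN : j + d ≤ N) :
    ∑ n ∈ Finset.range (N + 1), SmonCoprime F π n j = 0 := by
  rw [← neg_eq_zero, ← sumCoprime_eq_neg_sum F π (N + 1) j hdvd]
  exact sumCoprime_eq_zero F π hπm.ne_zero (N + 1) j (by omega)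
end

section
/- Let π ∈ A be monic irreducible of degree d ≥ 1, and let j ≥ 1 be an integer with (q−1) ∤ j. Then for every integer N ≥ j + d, Σ_{a ∈ A_+, deg a ≤ N, π ∤ a} a^j = (1 − π^j)·β(j) in A, where A_+ is the set of monic polynomials of A. (This is the integer form of the identity L_𝔭(1, j, ω_𝔭^i) = (1 − π^j) Z(1, j) = (1 − π^j) β(j) for odd characters.) -/
open Polynomial

/-- The monic polynomial of degree `n` with lower-order coefficients `c`. -/
noncomputable def monicOf {R : Type*} [Semiring R] (n : ℕ) (c : Fin n → R) : R[X] :=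
  X ^ n + ∑ i : Fin n, C (c i) * X ^ (i : ℕ)

lemma degree_sum_fin_C_mul_X_pow_lt {R : Type*} [Semiring R] (n : ℕ) (c : Fin n → R) :
    (∑ i : Fin n, C (c i) * X ^ (i : ℕ)).degree < (n : WithBot ℕ) := by
  refine (Polynomial.degree_sum_le _ _).trans_lt ?_
  refine (Finset.sup_lt_iff (WithBot.bot_lt_coe n)).2 fun i _ => ?_
  exact (degree_C_mul_X_pow_le _ _).trans_lt (Nat.cast_lt.2 i.2)

lemma monicOf_monic {R : Type*} [Semiring R] (n : ℕ) (c : Fin n → R) : (monicOf n c).Monic :=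
  monic_X_pow_add (degree_sum_fin_C_mul_X_pow_lt n c)

lemma natDegree_monicOf {R : Type*} [Semiring R] [Nontrivial R] (n : ℕ) (c : Fin n → R) :
    (monicOf n c).natDegree = n := by
  rw [monicOf, natDegree_add_eq_left_of_degree_lt, natDegree_X_pow]
  simpa using degree_sum_fin_C_mul_X_pow_lt n c

lemma coeff_monicOf {R : Type*} [Semiring R] (n : ℕ) (c : Fin n → R) (i : Fin n) :
    (monicOf n c).coeff i = c i := by
  simp [monicOf, coeff_X_pow, i.2.ne, Fin.val_inj]

lemma monicOf_injective {R : Type*} [Semiring R] (n : ℕ) :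
    Function.Injective (monicOf n : (Fin n → R) → R[X]) := fun c c' h => by
  ext i
  rw [← coeff_monicOf n c, h, coeff_monicOf]

lemma monicOf_coeff {R : Type*} [Semiring R] {p : R[X]} (hp : p.Monic) :
    monicOf p.natDegree (fun i => p.coeff i) = p := by
  conv_rhs => rw [hp.as_sum]
  rw [monicOf, Fin.sum_univ_eq_sum_range (fun i => C (p.coeff i) * X ^ i)]

/-- The finite set of monic polynomials of degree `n` over a finite field. -/
noncomputable def monicFinset (F : Type*) [Field F] [Fintype F] (n : ℕ) : Finset F[X] :=
  Finset.univ.map ⟨monicOf n, monicOf_injective n⟩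

lemma mem_monicFinset {F : Type*} [Field F] [Fintype F] {n : ℕ} {p : F[X]} :
    p ∈ monicFinset F n ↔ p.Monic ∧ p.natDegree = n := by
  simp only [monicFinset, Finset.mem_map, Finset.mem_univ, true_and, Function.Embedding.coeFn_mk]
  constructor
  · rintro ⟨c, rfl⟩
    exact ⟨monicOf_monic n c, natDegree_monicOf n c⟩
  · rintro ⟨hp, rfl⟩
    exact ⟨_, monicOf_coeff hp⟩

lemma Smon_eq_sum_monicFinset (F : Type) [Field F] [Fintype F] (n j : ℕ) :
    Smon F n j = ∑ a ∈ monicFinset F n, a ^ j := by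
  simp [Smon, monicFinset, monicOf]

open scoped Classical in
lemma SmonCoprime_eq_sum_monicFinset (F : Type) [Field F] [Fintype F] (π : F[X]) (n j : ℕ) :
    SmonCoprime F π n j = ∑ a ∈ monicFinset F n with ¬ π ∣ a, a ^ j := by
  rw [SmonCoprime, monicFinset, Finset.filter_map, Finset.sum_map]
  rfl

/-- A power sum over an affine space of dimension `n` over a finite field vanishes when the
exponent is less than `n`. -/
lemma sum_add_sum_mul_pow_eq_zero {F R : Type*} [Field F] [Fintype F] [CommRing R] (f : F →+* R)
    {n j : ℕ} (hj : j < n) (x : R) (v : Fin n → R) :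
    ∑ c : Fin n → F, (x + ∑ i, f (c i) * v i) ^ j = 0 := by
  induction n generalizing j with
  | zero => omega
  | succ n ih =>
    rw [← (Fin.consEquiv fun _ : Fin (n + 1) => F).sum_comp, Fintype.sum_prod_type_right]
    have expand : ∀ (c : Fin n → F) (a : F),
        (x + ∑ i, f ((Fin.consEquiv fun _ : Fin (n + 1) => F) (a, c) i) * v i) ^ j =
          ∑ k ∈ Finset.range (j + 1), (x + ∑ i, f (c i) * v i.succ) ^ k *
            (f (a ^ (j - k)) * v 0 ^ (j - k) * (j.choose k : R)) := by
      intro c a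
      rw [Fin.sum_univ_succ]
      simp only [Fin.consEquiv_apply, Fin.cons_zero, Fin.cons_succ]
      rw [add_left_comm, add_comm, add_pow]
      refine Finset.sum_congr rfl fun k _ => ?_
      rw [mul_pow, map_pow]
      ring
    simp only [expand]
    rw [Finset.sum_congr rfl fun c _ => Finset.sum_comm, Finset.sum_comm]
    refine Finset.sum_eq_zero fun k hk => ?_
    simp only [← Finset.mul_sum, ← Finset.sum_mul]
    rcases (Nat.lt_succ_iff.1 (Finset.mem_range.1 hk)).lt_or_eq with hkj | rfl
    · rw [ih (by omega), zero_mul]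
    · simp [← map_natCast f]

lemma Smon_eq_zero (F : Type) [Field F] [Fintype F] {n j : ℕ} (hj : j < n) : Smon F n j = 0 :=
  sum_add_sum_mul_pow_eq_zero (C : F →+* F[X]) hj (X ^ n) fun i => X ^ (i : ℕ)

lemma sum_range_Smon (F : Type) [Field F] [Fintype F] {j M : ℕ} (hM : j + 1 ≤ M) :
    ∑ n ∈ Finset.range M, Smon F n j = ∑ n ∈ Finset.range (j + 1), Smon F n j := by
  symm
  apply Finset.sum_subset (Finset.range_subset_range.2 hM)
  intro n _ hn
  exact Smon_eq_zero F (not_lt.1 fun h => hn (Finset.mem_range.2 h))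

lemma bg_eq_sum_Smon (F : Type) [Field F] [Fintype F] {j : ℕ} (hj : ¬ (Fintype.card F - 1) ∣ j) :
    bg F j = ∑ n ∈ Finset.range (j + 1), Smon F n j := by
  rw [bg, if_pos (Or.inr hj), Zpoly, eval_finsetSum, ← sum_range_Smon F (Nat.le_succ _)]
  simp

open scoped Classical in
lemma Smon_eq_SmonCoprime_add (F : Type) [Field F] [Fintype F] (π : F[X]) (n j : ℕ) :
    Smon F n j = SmonCoprime F π n j + ∑ a ∈ monicFinset F n with π ∣ a, a ^ j := by
  rw [Smon_eq_sum_monicFinset, SmonCoprime_eq_sum_monicFinset, add_comm,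
    Finset.sum_filter_add_sum_filter_not]

lemma SmonCoprime_of_lt_natDegree (F : Type) [Field F] [Fintype F] {π : F[X]} {n : ℕ}
    (hn : n < π.natDegree) (j : ℕ) : SmonCoprime F π n j = Smon F n j := by
  classical
  rw [Smon_eq_SmonCoprime_add F π, Finset.filter_false_of_mem, Finset.sum_empty, add_zero]
  intro a ha hdvd
  obtain ⟨hm, rfl⟩ := mem_monicFinset.1 ha
  exact hn.not_ge (natDegree_le_of_dvd hdvd hm.ne_zero)

lemma SmonCoprime_add_natDegree (F : Type) [Field F] [Fintype F] {π : F[X]} (hπ : π.Monic)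
    (n j : ℕ) :
    SmonCoprime F π (π.natDegree + n) j = Smon F (π.natDegree + n) j - π ^ j * Smon F n j := by
  classical
  rw [Smon_eq_SmonCoprime_add F π, eq_sub_iff_add_eq, add_right_inj, Smon_eq_sum_monicFinset,
    Finset.mul_sum]
  refine Finset.sum_bij (fun a _ => π * a) ?_ ?_ ?_ ?_
  · intro a ha
    obtain ⟨hm, rfl⟩ := mem_monicFinset.1 ha
    exact Finset.mem_filter.2
      ⟨mem_monicFinset.2 ⟨hπ.mul hm, hπ.natDegree_mul hm⟩, dvd_mul_right π a⟩
  · exact fun a _ b _ h => mul_left_cancel₀ hπ.ne_zero h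
  · intro b hb
    obtain ⟨hb, a, rfl⟩ := Finset.mem_filter.1 hb
    obtain ⟨hm, hdeg⟩ := mem_monicFinset.1 hb
    have ha : a.Monic := hπ.of_mul_monic_left hm
    rw [hπ.natDegree_mul ha, add_right_inj] at hdeg
    exact ⟨a, mem_monicFinset.2 ⟨ha, hdeg⟩, rfl⟩
  · exact fun a _ => (mul_pow π a j).symm

/-- For `π` monic irreducible of degree `d ≥ 1` and `j ≥ 1` with `(q-1) ∤ j`, for every
`N ≥ j + d` one has `Σ_{a ∈ A_+, deg a ≤ N, π ∤ a} a^j = (1 - π^j)·β(j)` in `A`. -/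
theorem stmt8 (F : Type) [Field F] [Fintype F] (hq : 3 ≤ Fintype.card F)
    (π : Polynomial F) (d : ℕ) (hd : 1 ≤ d) (hπm : π.Monic) (hπi : Irreducible π)
    (hπd : π.natDegree = d) (j : ℕ) (hj : 1 ≤ j) (hndvd : ¬ (Fintype.card F - 1) ∣ j)
    (N : ℕ) (hN : j + d ≤ N) :
    ∑ n ∈ Finset.range (N + 1), SmonCoprime F π n j = (1 - π ^ j) * bg F j := by
  obtain ⟨M, rfl⟩ : ∃ M, N = d + M := ⟨N - d, by omega⟩
  subst hπd
  rw [add_assoc, Finset.sum_range_add, Finset.sum_congr rfl fun n hn =>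
      SmonCoprime_of_lt_natDegree F (Finset.mem_range.1 hn) j,
    Finset.sum_congr rfl fun n _ => SmonCoprime_add_natDegree F hπm n j,
    Finset.sum_sub_distrib, ← add_sub_assoc, ← Finset.sum_range_add, ← Finset.mul_sum,
    sum_range_Smon F (M := π.natDegree + (M + 1)) (by omega),
    sum_range_Smon F (M := M + 1) (by omega), bg_eq_sum_Smon F hndvd]
  ring
end
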